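/- Let F be a field of characteristic 2 and A = (a_{ij}) a 3×3 matrix over F, and let R = (R_{ij}) be the 2×2×2 cubic block of A in 4×4 block form. Then for all 1 ≤ k < l ≤ 3, the products satisfy R_{kl} R_{lk} = R_{lk} R_{kl} = a_{kl}^2 a_{lk}^2 · 1_4. -/

import Mathlib

open Matrix

/-- Index of the 12 lattice lines of the 2×2×2 cube: `(axis, the two
coordinates of the line in the remaining two directions)`. Each axis
direction contributes the 4-dimensional thick space `F^4`. -/
abbrev Idx3 := Fin 3 × Fin 2 × Fin 2

/-- The line through the vertex `x ∈ {0,1}³` parallel to the `i`-th axis. -/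
def line3 (x : Fin 2 × Fin 2 × Fin 2) (i : Fin 3) : Idx3 :=
  (i, if i = 0 then x.2.1 else x.1, if i = 2 then x.2.1 else x.2.2)

/-- The copy `A⁽ˣ⁾` of the 3×3 brick `A` at the vertex `x` of the unit cube:
it acts (on row vectors from the right) as `A` on the three lines through `x`
and as the identity on the other lines. -/
def cubeCopy {F : Type*} [Field F] (A : Matrix (Fin 3) (Fin 3) F)
    (x : Fin 2 × Fin 2 × Fin 2) : Matrix Idx3 Idx3 F :=
  Matrix.of fun u v =>
    if u = line3 x u.1 ∧ v = line3 x v.1 then A u.1 v.1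
    else if u = v then 1 else 0

/-- The 2×2×2 cubic block `R`: the product of the 8 copies `A⁽ˣ⁾`,
`x ∈ {0,1}³`, taken in an order compatible with the coordinatewise
partial order. -/
def cubeBlock {F : Type*} [Field F] (A : Matrix (Fin 3) (Fin 3) F) :
    Matrix Idx3 Idx3 F :=
  cubeCopy A (0, 0, 0) * cubeCopy A (1, 0, 0) * cubeCopy A (0, 1, 0) *
  cubeCopy A (0, 0, 1) * cubeCopy A (1, 1, 0) * cubeCopy A (1, 0, 1) *
  cubeCopy A (0, 1, 1) * cubeCopy A (1, 1, 1)

/-- The 4×4 block `R_{ij}` of the cubic block, mapping the `i`-th thick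
space to the `j`-th thick space. -/
def cubeBlk {F : Type*} [Field F] (A : Matrix (Fin 3) (Fin 3) F) (i j : Fin 3) :
    Matrix (Fin 2 × Fin 2) (Fin 2 × Fin 2) F :=
  Matrix.of fun u v => cubeBlock A (i, u) (j, v)

theorem mul_cubeCopy_apply {F : Type*} [Field F] (A : Matrix (Fin 3) (Fin 3) F)
    (x : Fin 2 × Fin 2 × Fin 2) (M : Matrix Idx3 Idx3 F) (u w : Idx3) :
    (M * cubeCopy A x) u w =
      if w = line3 x w.1 then ∑ i, M u (line3 x i) * A i w.1 else M u w := by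
  rw [Matrix.mul_apply]
  split_ifs with h
  · rw [← Finset.sum_subset (Finset.subset_univ (Finset.univ.image (line3 x))),
      Finset.sum_image fun i _ j _ hij => congrArg Prod.fst hij]
    · refine Finset.sum_congr rfl fun i _ => ?_
      simp only [cubeCopy, Matrix.of_apply]
      rw [if_pos ⟨rfl, h⟩]
      rfl
    · intro v _ hv
      have h₁ : v ≠ line3 x v.1 := fun e =>
        hv (Finset.mem_image.2 ⟨v.1, Finset.mem_univ _, e.symm⟩)
      have h₂ : v ≠ w := fun e => h₁ (e ▸ h)
      simp [cubeCopy, h₁, h₂]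
  · simp [cubeCopy, h]

theorem cubeCopy_apply {F : Type*} [Field F] (A : Matrix (Fin 3) (Fin 3) F)
    (x : Fin 2 × Fin 2 × Fin 2) (u v : Idx3) :
    cubeCopy A x u v =
      if u = line3 x u.1 ∧ v = line3 x v.1 then A u.1 v.1 else if u = v then 1 else 0 :=
  rfl

theorem mul_cubeCopy_apply_zero {F : Type*} [Field F] (A : Matrix (Fin 3) (Fin 3) F)
    (x y z : Fin 2) (M : Matrix Idx3 Idx3 F) (u : Idx3) (p q : Fin 2) :
    (M * cubeCopy A (x, y, z)) u (0, p, q) =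
      if p = y ∧ q = z then
        M u (0, y, z) * A 0 0 + M u (1, x, z) * A 1 0 + M u (2, x, y) * A 2 0
      else M u (0, p, q) := by
  simp [mul_cubeCopy_apply, line3, Fin.sum_univ_three]

theorem mul_cubeCopy_apply_one {F : Type*} [Field F] (A : Matrix (Fin 3) (Fin 3) F)
    (x y z : Fin 2) (M : Matrix Idx3 Idx3 F) (u : Idx3) (p q : Fin 2) :
    (M * cubeCopy A (x, y, z)) u (1, p, q) =
      if p = x ∧ q = z then
        M u (0, y, z) * A 0 1 + M u (1, x, z) * A 1 1 + M u (2, x, y) * A 2 1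
      else M u (1, p, q) := by
  simp [mul_cubeCopy_apply, line3, Fin.sum_univ_three]

theorem mul_cubeCopy_apply_two {F : Type*} [Field F] (A : Matrix (Fin 3) (Fin 3) F)
    (x y z : Fin 2) (M : Matrix Idx3 Idx3 F) (u : Idx3) (p q : Fin 2) :
    (M * cubeCopy A (x, y, z)) u (2, p, q) =
      if p = x ∧ q = y then
        M u (0, y, z) * A 0 2 + M u (1, x, z) * A 1 2 + M u (2, x, y) * A 2 2
      else M u (2, p, q) := by
  simp [mul_cubeCopy_apply, line3, Fin.sum_univ_three]

/-- The lexicographic enumeration of the four lines parallel to an axis. -/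
def lineEquiv : Fin 2 × Fin 2 ≃ Fin 4 := finProdFinEquiv

theorem lineEquiv_zero_zero : lineEquiv (0, 0) = 0 := rfl

theorem lineEquiv_zero_one : lineEquiv (0, 1) = 1 := rfl

theorem lineEquiv_one_zero : lineEquiv (1, 0) = 2 := rfl

theorem lineEquiv_one_one : lineEquiv (1, 1) = 3 := rfl

set_option maxHeartbeats 1000000 in
theorem cubeBlk_zero_one {F : Type*} [Field F] (A : Matrix (Fin 3) (Fin 3) F) :
    cubeBlk A 0 1 =
      (!![A 0 1 * A 1 1,
         A 0 1 * A 1 2 * A 2 1 + A 0 2 * A 1 1 * A 2 1,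
         A 0 0 * A 0 1 * A 1 1 + A 0 1 ^ 2 * A 1 0,
         A 0 0 * A 0 1 * A 1 2 * A 2 1 + A 0 0 * A 0 2 * A 1 1 * A 2 1 +
           A 0 1 ^ 2 * A 1 2 * A 2 0 + 2 * A 0 1 * A 0 2 * A 1 0 * A 2 1 +
           A 0 1 * A 0 2 * A 1 1 * A 2 0;
       0, A 0 1 * A 1 1, 0, A 0 0 * A 0 1 * A 1 1 + A 0 1 ^ 2 * A 1 0;
       A 0 1, A 0 2 * A 2 1, A 0 0 * A 0 1, A 0 0 * A 0 2 * A 2 1 + A 0 1 * A 0 2 * A 2 0;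
       0, A 0 1, 0, A 0 0 * A 0 1] : Matrix (Fin 4) (Fin 4) F).submatrix
        lineEquiv lineEquiv := by
  ext ⟨a, b⟩ ⟨c, d⟩
  revert a b c d
  simp only [Fin.forall_fin_two]
  repeat' apply And.intro
  all_goals
    simp only [cubeBlk, cubeBlock, Matrix.of_apply, Matrix.submatrix_apply, lineEquiv_zero_zero,
      lineEquiv_zero_one, lineEquiv_one_zero, lineEquiv_one_one, ↓mul_cubeCopy_apply_zero,
      ↓mul_cubeCopy_apply_one, ↓mul_cubeCopy_apply_two, cubeCopy_apply, line3, Prod.mk.injEq,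
      zero_ne_one, one_ne_zero, and_true, and_false, and_self, Fin.isValue, Fin.reduceEq,
      reduceIte, zero_mul, one_mul, add_zero, zero_add, Matrix.cons_val]
  all_goals ring

set_option maxHeartbeats 1000000 in
theorem cubeBlk_one_zero {F : Type*} [Field F] (A : Matrix (Fin 3) (Fin 3) F) :
    cubeBlk A 1 0 =
      (!![A 0 0 * A 1 0,
         A 0 0 * A 1 2 * A 2 0 + A 0 2 * A 1 0 * A 2 0,
         A 0 0 * A 1 0 * A 1 1 + A 0 1 * A 1 0 ^ 2,
         A 0 0 * A 1 0 * A 1 2 * A 2 1 + A 0 0 * A 1 1 * A 1 2 * A 2 0 +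
           2 * A 0 1 * A 1 0 * A 1 2 * A 2 0 + A 0 2 * A 1 0 ^ 2 * A 2 1 +
           A 0 2 * A 1 0 * A 1 1 * A 2 0;
       0, A 0 0 * A 1 0, 0, A 0 0 * A 1 0 * A 1 1 + A 0 1 * A 1 0 ^ 2;
       A 1 0, A 1 2 * A 2 0, A 1 0 * A 1 1, A 1 0 * A 1 2 * A 2 1 + A 1 1 * A 1 2 * A 2 0;
       0, A 1 0, 0, A 1 0 * A 1 1] : Matrix (Fin 4) (Fin 4) F).submatrix
        lineEquiv lineEquiv := by
  ext ⟨a, b⟩ ⟨c, d⟩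
  revert a b c d
  simp only [Fin.forall_fin_two]
  repeat' apply And.intro
  all_goals
    simp only [cubeBlk, cubeBlock, Matrix.of_apply, Matrix.submatrix_apply, lineEquiv_zero_zero,
      lineEquiv_zero_one, lineEquiv_one_zero, lineEquiv_one_one, ↓mul_cubeCopy_apply_zero,
      ↓mul_cubeCopy_apply_one, ↓mul_cubeCopy_apply_two, cubeCopy_apply, line3, Prod.mk.injEq,
      zero_ne_one, one_ne_zero, and_true, and_false, and_self, Fin.isValue, Fin.reduceEq,
      reduceIte, zero_mul, one_mul, add_zero, zero_add, Matrix.cons_val]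
  all_goals ring

set_option maxHeartbeats 1000000 in
theorem cubeBlk_zero_two {F : Type*} [Field F] (A : Matrix (Fin 3) (Fin 3) F) :
    cubeBlk A 0 2 =
      (!![A 0 2 * A 2 2,
         A 0 1 * A 1 2 * A 2 2 + A 0 2 * A 1 2 * A 2 1,
         A 0 0 * A 0 2 * A 2 2 + A 0 2 ^ 2 * A 2 0,
         A 0 0 * A 0 1 * A 1 2 * A 2 2 + A 0 0 * A 0 2 * A 1 2 * A 2 1 +
           A 0 1 * A 0 2 * A 1 0 * A 2 2 + 2 * A 0 1 * A 0 2 * A 1 2 * A 2 0 +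
           A 0 2 ^ 2 * A 1 0 * A 2 1;
       A 0 2, A 0 1 * A 1 2, A 0 0 * A 0 2, A 0 0 * A 0 1 * A 1 2 + A 0 1 * A 0 2 * A 1 0;
       0, A 0 2 * A 2 2, 0, A 0 0 * A 0 2 * A 2 2 + A 0 2 ^ 2 * A 2 0;
       0, A 0 2, 0, A 0 0 * A 0 2] : Matrix (Fin 4) (Fin 4) F).submatrix
        lineEquiv lineEquiv := by
  ext ⟨a, b⟩ ⟨c, d⟩
  revert a b c d
  simp only [Fin.forall_fin_two]
  repeat' apply And.intro
  all_goals
    simp only [cubeBlk, cubeBlock, Matrix.of_apply, Matrix.submatrix_apply, lineEquiv_zero_zero,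
      lineEquiv_zero_one, lineEquiv_one_zero, lineEquiv_one_one, ↓mul_cubeCopy_apply_zero,
      ↓mul_cubeCopy_apply_one, ↓mul_cubeCopy_apply_two, cubeCopy_apply, line3, Prod.mk.injEq,
      zero_ne_one, one_ne_zero, and_true, and_false, and_self, Fin.isValue, Fin.reduceEq,
      reduceIte, zero_mul, one_mul, add_zero, zero_add, Matrix.cons_val]
  all_goals ring

set_option maxHeartbeats 1000000 in
theorem cubeBlk_two_zero {F : Type*} [Field F] (A : Matrix (Fin 3) (Fin 3) F) :
    cubeBlk A 2 0 =
      (!![A 0 0 * A 2 0,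
         A 0 0 * A 2 0 * A 2 2 + A 0 2 * A 2 0 ^ 2,
         A 0 0 * A 1 0 * A 2 1 + A 0 1 * A 1 0 * A 2 0,
         A 0 0 * A 1 0 * A 2 1 * A 2 2 + A 0 0 * A 1 2 * A 2 0 * A 2 1 +
           A 0 1 * A 1 0 * A 2 0 * A 2 2 + A 0 1 * A 1 2 * A 2 0 ^ 2 +
           2 * A 0 2 * A 1 0 * A 2 0 * A 2 1;
       0, 0, A 0 0 * A 2 0, A 0 0 * A 2 0 * A 2 2 + A 0 2 * A 2 0 ^ 2;
       A 2 0, A 2 0 * A 2 2, A 1 0 * A 2 1, A 1 0 * A 2 1 * A 2 2 + A 1 2 * A 2 0 * A 2 1;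
       0, 0, A 2 0, A 2 0 * A 2 2] : Matrix (Fin 4) (Fin 4) F).submatrix
        lineEquiv lineEquiv := by
  ext ⟨a, b⟩ ⟨c, d⟩
  revert a b c d
  simp only [Fin.forall_fin_two]
  repeat' apply And.intro
  all_goals
    simp only [cubeBlk, cubeBlock, Matrix.of_apply, Matrix.submatrix_apply, lineEquiv_zero_zero,
      lineEquiv_zero_one, lineEquiv_one_zero, lineEquiv_one_one, ↓mul_cubeCopy_apply_zero,
      ↓mul_cubeCopy_apply_one, ↓mul_cubeCopy_apply_two, cubeCopy_apply, line3, Prod.mk.injEq,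
      zero_ne_one, one_ne_zero, and_true, and_false, and_self, Fin.isValue, Fin.reduceEq,
      reduceIte, zero_mul, one_mul, add_zero, zero_add, Matrix.cons_val]
  all_goals ring

set_option maxHeartbeats 1000000 in
theorem cubeBlk_one_two {F : Type*} [Field F] (A : Matrix (Fin 3) (Fin 3) F) :
    cubeBlk A 1 2 =
      (!![A 1 2 * A 2 2,
         A 1 1 * A 1 2 * A 2 2 + A 1 2 ^ 2 * A 2 1,
         A 0 2 * A 1 0 * A 2 2 + A 0 2 * A 1 2 * A 2 0,
         A 0 1 * A 1 0 * A 1 2 * A 2 2 + A 0 1 * A 1 2 ^ 2 * A 2 0 +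
           A 0 2 * A 1 0 * A 1 1 * A 2 2 + 2 * A 0 2 * A 1 0 * A 1 2 * A 2 1 +
           A 0 2 * A 1 1 * A 1 2 * A 2 0;
       A 1 2, A 1 1 * A 1 2, A 0 2 * A 1 0, A 0 1 * A 1 0 * A 1 2 + A 0 2 * A 1 0 * A 1 1;
       0, 0, A 1 2 * A 2 2, A 1 1 * A 1 2 * A 2 2 + A 1 2 ^ 2 * A 2 1;
       0, 0, A 1 2, A 1 1 * A 1 2] : Matrix (Fin 4) (Fin 4) F).submatrix
        lineEquiv lineEquiv := by
  ext ⟨a, b⟩ ⟨c, d⟩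
  revert a b c d
  simp only [Fin.forall_fin_two]
  repeat' apply And.intro
  all_goals
    simp only [cubeBlk, cubeBlock, Matrix.of_apply, Matrix.submatrix_apply, lineEquiv_zero_zero,
      lineEquiv_zero_one, lineEquiv_one_zero, lineEquiv_one_one, ↓mul_cubeCopy_apply_zero,
      ↓mul_cubeCopy_apply_one, ↓mul_cubeCopy_apply_two, cubeCopy_apply, line3, Prod.mk.injEq,
      zero_ne_one, one_ne_zero, and_true, and_false, and_self, Fin.isValue, Fin.reduceEq,
      reduceIte, zero_mul, one_mul, add_zero, zero_add, Matrix.cons_val]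
  all_goals ring

set_option maxHeartbeats 1000000 in
theorem cubeBlk_two_one {F : Type*} [Field F] (A : Matrix (Fin 3) (Fin 3) F) :
    cubeBlk A 2 1 =
      (!![A 1 1 * A 2 1,
         A 1 1 * A 2 1 * A 2 2 + A 1 2 * A 2 1 ^ 2,
         A 0 1 * A 1 0 * A 2 1 + A 0 1 * A 1 1 * A 2 0,
         A 0 1 * A 1 0 * A 2 1 * A 2 2 + A 0 1 * A 1 1 * A 2 0 * A 2 2 +
           2 * A 0 1 * A 1 2 * A 2 0 * A 2 1 + A 0 2 * A 1 0 * A 2 1 ^ 2 +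
           A 0 2 * A 1 1 * A 2 0 * A 2 1;
       A 2 1, A 2 1 * A 2 2, A 0 1 * A 2 0, A 0 1 * A 2 0 * A 2 2 + A 0 2 * A 2 0 * A 2 1;
       0, 0, A 1 1 * A 2 1, A 1 1 * A 2 1 * A 2 2 + A 1 2 * A 2 1 ^ 2;
       0, 0, A 2 1, A 2 1 * A 2 2] : Matrix (Fin 4) (Fin 4) F).submatrix
        lineEquiv lineEquiv := by
  ext ⟨a, b⟩ ⟨c, d⟩
  revert a b c d
  simp only [Fin.forall_fin_two]
  repeat' apply And.intro
  all_goals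
    simp only [cubeBlk, cubeBlock, Matrix.of_apply, Matrix.submatrix_apply, lineEquiv_zero_zero,
      lineEquiv_zero_one, lineEquiv_one_zero, lineEquiv_one_one, ↓mul_cubeCopy_apply_zero,
      ↓mul_cubeCopy_apply_one, ↓mul_cubeCopy_apply_two, cubeCopy_apply, line3, Prod.mk.injEq,
      zero_ne_one, one_ne_zero, and_true, and_false, and_self, Fin.isValue, Fin.reduceEq,
      reduceIte, zero_mul, one_mul, add_zero, zero_add, Matrix.cons_val]
  all_goals ring

set_option maxHeartbeats 1000000 in
theorem stmt_5 (F : Type*) [Field F] [CharP F 2] (A : Matrix (Fin 3) (Fin 3) F) :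
    ∀ k l : Fin 3, k < l →
      cubeBlk A k l * cubeBlk A l k
        = ((A k l) ^ 2 * (A l k) ^ 2) • (1 : Matrix (Fin 2 × Fin 2) (Fin 2 × Fin 2) F) ∧
      cubeBlk A l k * cubeBlk A k l
        = ((A k l) ^ 2 * (A l k) ^ 2) • (1 : Matrix (Fin 2 × Fin 2) (Fin 2 × Fin 2) F) := by
  intro k l hkl
  have two : (2 : F) = 0 := CharTwo.two_eq_zero
  have smul_one_eq (c : F) : c • (1 : Matrix (Fin 2 × Fin 2) (Fin 2 × Fin 2) F) =
      (c • (1 : Matrix (Fin 4) (Fin 4) F)).submatrix lineEquiv lineEquiv := by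
    rw [Matrix.submatrix_smul, Pi.smul_apply, Pi.smul_apply, Matrix.submatrix_one_equiv]
  rw [smul_one_eq]
  obtain ⟨rfl, rfl⟩ | ⟨rfl, rfl⟩ | ⟨rfl, rfl⟩ :
      k = 0 ∧ l = 1 ∨ k = 0 ∧ l = 2 ∨ k = 1 ∧ l = 2 := by
    decide +revert
  on_goal 1 => rw [cubeBlk_zero_one, cubeBlk_one_zero]
  on_goal 2 => rw [cubeBlk_zero_two, cubeBlk_two_zero]
  on_goal 3 => rw [cubeBlk_one_two, cubeBlk_two_one]
  all_goals
    rw [Matrix.submatrix_mul_equiv, Matrix.submatrix_mul_equiv]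
    constructor <;> congr 1 <;> ext i j <;> revert i j <;>
      simp only [Fin.forall_fin_succ, IsEmpty.forall_iff, and_true, Fin.isValue,
        Fin.succ_zero_eq_one, Fin.succ_one_eq_two, Fin.reduceSucc, Matrix.mul_apply,
        Fin.sum_univ_four, Matrix.of_apply, Matrix.cons_val, Matrix.smul_apply, Matrix.one_apply,
        Fin.reduceEq, reduceIte, smul_eq_mul, mul_one, mul_zero, zero_mul, add_zero, zero_add,
        two] <;>
      refine ⟨⟨?_, ?_, ?_, ?_⟩, ⟨?_, ?_, ?_, ?_⟩, ⟨?_, ?_, ?_, ?_⟩, ⟨?_, ?_, ?_, ?_⟩⟩ <;> grind
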